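/- Let G be a graph with n vertices, m edges, and unit edge lengths, and let k ≥ 0 be an integer with 2k ≤ n. Let U be a set of k vertices of maximum degree and C the set of all edges incident to U. Then |C| ≥ k·m/n, and C is a (1, 2k)-contraction: dist_{ℓ_C}(u,v) ≥ dist(u,v) − 2k for all vertices u, v. -/

import Mathlib

open Classical

noncomputable def walkLen {V : Type*} (G : SimpleGraph V) (ℓ : Sym2 V → ℝ)
    {u v : V} (w : G.Walk u v) : ℝ := (w.edges.map ℓ).sum

noncomputable def gdist {V : Type*} (G : SimpleGraph V) (ℓ : Sym2 V → ℝ) (u v : V) : ℝ :=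
  sInf {x : ℝ | ∃ w : G.Walk u v, walkLen G ℓ w = x}

noncomputable def zeroOn {V : Type*} (ℓ : Sym2 V → ℝ) (C : Set (Sym2 V)) : Sym2 V → ℝ :=
  fun e => if e ∈ C then 0 else ℓ e

theorem hdc_aux {V : Type*} (G : SimpleGraph V) (U : Finset V)
    (C : Set (Sym2 V)) (hC : C = {e | e ∈ G.edgeSet ∧ ∃ x ∈ U, x ∈ e})
    {u v : V} (w : G.Walk u v) :
    (w.length : ℝ) + (if u ∈ U then 1 else 0) ≤
      walkLen G (zeroOn (fun _ => (1 : ℝ)) C) w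
        + 2 * ((w.support.countP (fun x => decide (x ∈ U)) : ℕ) : ℝ) := by
  induction w with
  | nil =>
    simp only [walkLen, SimpleGraph.Walk.length_nil, SimpleGraph.Walk.edges_nil,
      SimpleGraph.Walk.support_nil, List.countP_singleton]
    split_ifs <;> simp_all
  | @cons a b c h p ih =>
    have key : (1 : ℝ) ≤ (if a ∈ U then 1 else 0) + (if b ∈ U then 1 else 0)
        + zeroOn (fun _ => (1 : ℝ)) C s(a, b) := by
      unfold zeroOn
      by_cases ha : a ∈ U
      · simp only [ha, if_true]
        split_ifs <;> norm_num
      · by_cases hb : b ∈ U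
        · simp only [hb, if_true]
          split_ifs <;> norm_num
        · have : s(a, b) ∉ C := by
            rw [hC]
            rintro ⟨_, x, hx, hxe⟩
            rcases Sym2.mem_iff.1 hxe with rfl | rfl <;> contradiction
          simp [this, ha, hb]
    simp only [walkLen, SimpleGraph.Walk.length_cons, SimpleGraph.Walk.edges_cons,
      SimpleGraph.Walk.support_cons, List.countP_cons, List.map_cons, List.sum_cons,
      decide_eq_true_eq] at ih ⊢
    push_cast
    linarith

theorem hdc_zero_nonneg {V : Type*} (C : Set (Sym2 V)) (e : Sym2 V) :
    0 ≤ zeroOn (fun _ => (1 : ℝ)) C e := by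
  unfold zeroOn
  split_ifs <;> norm_num

theorem hdc_walk {V : Type*} (G : SimpleGraph V) (U : Finset V)
    (C : Set (Sym2 V)) (hC : C = {e | e ∈ G.edgeSet ∧ ∃ x ∈ U, x ∈ e})
    {u v : V} (w : G.Walk u v) :
    gdist G (fun _ => (1 : ℝ)) u v - 2 * U.card ≤
      walkLen G (zeroOn (fun _ => (1 : ℝ)) C) w := by
  have h1 := hdc_aux G U C hC w.bypass
  have hn : w.bypass.support.Nodup := (SimpleGraph.Walk.bypass_isPath w).support_nodup
  have h2 : w.bypass.support.countP (fun x => decide (x ∈ U)) ≤ U.card := by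
    rw [List.countP_eq_length_filter,
      ← List.toFinset_card_of_nodup (hn.filter _)]
    apply Finset.card_le_card
    intro x hx
    simp at hx
    exact hx.2
  have h3 : gdist G (fun _ => (1 : ℝ)) u v ≤ w.bypass.length := by
    apply csInf_le
    · refine ⟨0, ?_⟩
      rintro x ⟨p, rfl⟩
      simp [walkLen]
    · exact ⟨w.bypass, by simp [walkLen]⟩
  have h4 : walkLen G (zeroOn (fun _ => (1 : ℝ)) C) w.bypass ≤
      walkLen G (zeroOn (fun _ => (1 : ℝ)) C) w := by
    unfold walkLen
    have hs : (w.bypass.edges).Subperm w.edges :=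
      List.subperm_of_subset (SimpleGraph.Walk.bypass_isPath w).isTrail.edges_nodup
        (SimpleGraph.Walk.edges_bypass_subset w)
    obtain ⟨l, hl, hl2⟩ := hs
    rw [← (hl.map _).sum_eq]
    apply (hl2.map _).sum_le_sum
    intro a ha
    obtain ⟨e, _, rfl⟩ := List.mem_map.1 ha
    exact hdc_zero_nonneg C e
  have h5 : (0 : ℝ) ≤ (if u ∈ U then 1 else 0) := by split_ifs <;> norm_num
  have h6 : ((w.bypass.support.countP (fun x => decide (x ∈ U)) : ℕ) : ℝ) ≤ U.card := by
    exact_mod_cast h2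
  linarith

theorem hdc_deg {V : Type*} [Fintype V] (f : V → ℕ) (U : Finset V)
    (h : ∀ u ∈ U, ∀ v ∉ U, f v ≤ f u) :
    U.card * ∑ v, f v ≤ Fintype.card V * ∑ u ∈ U, f u := by
  have h1 : ∑ u ∈ U, ∑ v ∈ Uᶜ, f v ≤ ∑ u ∈ U, ∑ v ∈ Uᶜ, f u :=
    Finset.sum_le_sum fun u hu => Finset.sum_le_sum fun v hv =>
      h u hu v (Finset.mem_compl.1 hv)
  simp only [Finset.sum_const, smul_eq_mul, ← Finset.mul_sum] at h1
  rw [← Finset.sum_add_sum_compl U f, ← Finset.card_add_card_compl U]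
  nlinarith

theorem hdc_count {V : Type*} [Fintype V] (G : SimpleGraph V) (U : Finset V)
    (C : Set (Sym2 V)) (hC : C = {e | e ∈ G.edgeSet ∧ ∃ x ∈ U, x ∈ e}) :
    ∑ u ∈ U, G.degree u ≤ 2 * C.ncard := by
  have h0 : ∀ u ∈ U, G.degree u = (C.toFinset.filter (fun e => u ∈ e)).card := by
    intro u hu
    rw [← SimpleGraph.card_incidenceFinset_eq_degree]
    congr 1
    ext e
    simp only [SimpleGraph.mem_incidenceFinset, SimpleGraph.incidenceSet, hC,
      Finset.mem_filter, Set.mem_toFinset, Set.mem_setOf_eq]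
    exact ⟨fun ⟨a, b⟩ => ⟨⟨a, u, hu, b⟩, b⟩, fun ⟨⟨a, _⟩, b⟩ => ⟨a, b⟩⟩
  rw [Finset.sum_congr rfl h0, Set.ncard_eq_toFinset_card']
  simp only [Finset.card_filter]
  rw [Finset.sum_comm, mul_comm, ← smul_eq_mul]
  apply Finset.sum_le_card_nsmul
  intro e _
  rw [← Finset.card_filter]
  induction e with
  | _ a b =>
    refine (Finset.card_le_card (t := {a, b}) ?_).trans Finset.card_le_two
    intro x hx
    simpa using (Finset.mem_filter.1 hx).2

theorem high_degree_contraction {V : Type*} [Fintype V] (G : SimpleGraph V)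
    (hconn : G.Connected) (k : ℕ) (hk : 2 * k ≤ Fintype.card V)
    (U : Finset V) (hUcard : U.card = k)
    (hUdeg : ∀ u ∈ U, ∀ v ∉ U, G.degree v ≤ G.degree u)
    (C : Set (Sym2 V)) (hC : C = {e | e ∈ G.edgeSet ∧ ∃ x ∈ U, x ∈ e}) :
    ((k : ℝ) * G.edgeSet.ncard / Fintype.card V ≤ C.ncard) ∧
    (∀ u v : V, gdist G (fun _ => (1 : ℝ)) u v - 2 * k ≤
        gdist G (zeroOn (fun _ => (1 : ℝ)) C) u v) := by
  refine ⟨?_, ?_⟩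
  · have hV : 0 < Fintype.card V := Fintype.card_pos_iff.2 hconn.nonempty
    have h1 := hdc_deg (fun v => G.degree v) U hUdeg
    have h2 := hdc_count G U C hC
    have h3 : ∑ v, G.degree v = 2 * G.edgeSet.ncard := by
      rw [G.sum_degrees_eq_twice_card_edges, Set.ncard_eq_toFinset_card']
      rfl
    rw [h3, hUcard] at h1
    have h4 : k * G.edgeSet.ncard ≤ C.ncard * Fintype.card V := by
      have := Nat.mul_le_mul_left (Fintype.card V) h2
      nlinarith
    rw [div_le_iff₀ (by exact_mod_cast hV)]
    exact_mod_cast h4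
  · intro u v
    obtain ⟨w0⟩ := hconn.preconnected u v
    refine le_csInf (s := {x : ℝ | ∃ w : G.Walk u v, walkLen G (zeroOn (fun _ => (1 : ℝ)) C) w = x}) ⟨_, w0, rfl⟩ ?_
    rintro x ⟨w, rfl⟩
    rw [← hUcard]
    exact hdc_walk G U C hC w
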